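/- arXiv:0712.1884 — 8 statements merged into one kernel-verified Lean document; each statement's English description precedes it below -/
import Mathlib

section
/- Sufficiency part of the colorability criterion: Let G be a finite simple graph and k ≥ 1. If there exists an equivalence class modulo k of orientations of G whose two adjacent subclasses have different cardinalities (i.e., the number of orientations in one subclass differs from the number in the other), then G admits a proper vertex coloring in at most k colors. -/
open Finset

variable {V : Type*} [Fintype V] [DecidableEq V]

/-- An orientation of a simple graph `G`: for each edge, a choice of the
source endpoint (the vertex the edge is directed away from). -/
abbrev SimpleGraph.Orient (G : SimpleGraph V) [DecidableRel G.Adj] : Type _ :=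
  {D : G.edgeFinset → V // ∀ e : G.edgeFinset, D e ∈ (e : Sym2 V)}

namespace SimpleGraph.Orient

variable {G : SimpleGraph V} [DecidableRel G.Adj]

/-- `s⁺_D(v)`: the outdegree of `v` under the orientation `D`, i.e. the number of
edges directed away from `v`. -/
abbrev outdeg (D : G.Orient) (v : V) : ℕ :=
  (Finset.univ.filter fun e : G.edgeFinset => D.1 e = v).card

/-- The head of the edge `e` under the orientation `D`: the endpoint of `e` other
than the source `D.1 e` (so `e` is directed as `(D.1 e, head D e)`). -/
abbrev head (D : G.Orient) (e : G.edgeFinset) : V :=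
  Sym2.Mem.other' (D.2 e)

/-- The number of edges on which two orientations differ. -/
abbrev flips (D D' : G.Orient) : ℕ :=
  (Finset.univ.filter fun e : G.edgeFinset => D.1 e ≠ D'.1 e).card

/-- Two orientations are congruent modulo `k` if the outdegrees of every vertex
are congruent modulo `k`. -/
abbrev CongMod (k : ℕ) (D D' : G.Orient) : Prop :=
  ∀ v : V, (outdeg D v : ZMod k) = (outdeg D' v : ZMod k)

/-- Two orientations agree if one is obtained from the other by reversing the
direction of an even number of edges. -/
abbrev Agree (D D' : G.Orient) : Prop := Even (flips D D')

end SimpleGraph.Orient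

open SimpleGraph.Orient

namespace SimpleGraph.Orient

variable {G : SimpleGraph V} [DecidableRel G.Adj]

/-- If `x` takes equal values at the ends of some edge, then the graph polynomial, expanded as a
signed sum over orientations, vanishes at `x`. -/
theorem sum_neg_one_pow_flips_mul_prod_eq_zero {R : Type*} [CommRing R] (D₀ : G.Orient)
    (x : V → R) {u v : V} (huv : G.Adj u v) (hx : x u = x v) :
    ∑ D : G.Orient, (-1) ^ flips D D₀ * ∏ w, x w ^ outdeg D w = 0 := by
  have expand : ∏ e : G.edgeFinset, ∑ w with w ∈ (e : Sym2 V),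
      (if w ≠ D₀.1 e then (-1 : R) else 1) * x w =
      ∑ D : G.Orient, (-1) ^ flips D D₀ * ∏ w, x w ^ outdeg D w := by
    rw [Finset.prod_univ_sum, Finset.sum_subtype (p := fun D : G.edgeFinset → V =>
      ∀ e : G.edgeFinset, D e ∈ (e : Sym2 V)) _ (by simp)]
    refine Finset.sum_congr rfl fun D _ => ?_
    rw [Finset.prod_mul_distrib, Finset.prod_ite, Finset.prod_const, Finset.prod_const_one,
      mul_one]
    congr 1
    rw [← Finset.prod_fiberwise (g := D.1)]
    refine Finset.prod_congr rfl fun w _ => ?_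
    exact Finset.prod_eq_pow_card fun e he => by rw [(Finset.mem_filter.mp he).2]
  rw [← expand]
  refine Finset.prod_eq_zero (Finset.mem_univ ⟨s(u, v), by simpa using huv⟩) ?_
  have ends : (Finset.univ.filter fun w => w ∈ s(u, v)) = {u, v} := by
    ext w; simp
  have hD : D₀.1 ⟨s(u, v), by simpa using huv⟩ = u ∨ D₀.1 ⟨s(u, v), by simpa using huv⟩ = v := by
    simpa using D₀.2 ⟨s(u, v), by simpa using huv⟩
  rw [ends, Finset.sum_pair huv.ne]
  rcases hD with hD | hD <;> simp [hD, hx, huv.ne, huv.ne']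

/-- Averaging over all assignments of `k`-th roots of unity extracts a congruence class. -/
theorem sum_prod_stdAddChar (k : ℕ) [NeZero k] (D D₀ : G.Orient) :
    ∑ c : V → ZMod k, ∏ w, ZMod.stdAddChar (c w * ((outdeg D w : ZMod k) - (outdeg D₀ w : ZMod k))) =
      if CongMod k D D₀ then (k : ℂ) ^ Fintype.card V else 0 := by
  rw [← Fintype.piFinset_univ, ← Finset.prod_univ_sum (fun _ => Finset.univ)
    (fun w a => ZMod.stdAddChar (a * ((outdeg D w : ZMod k) - (outdeg D₀ w : ZMod k))))]
  simp_rw [AddChar.sum_mulShift _ (ZMod.isPrimitive_stdAddChar k), sub_eq_zero, ZMod.card]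
  split_ifs with h
  · simp [h]
  · obtain ⟨w, hw⟩ := not_forall.mp h
    exact Finset.prod_eq_zero (Finset.mem_univ w) (by simp [hw])

/-- If `G` is not `k`-colorable, the signed count of every class modulo `k` is zero. -/
theorem sum_congMod_neg_one_pow_flips_eq_zero (k : ℕ) [NeZero k] (hG : ¬ G.Colorable k)
    (D₀ : G.Orient) : ∑ D : G.Orient with CongMod k D D₀, (-1 : ℂ) ^ flips D D₀ = 0 := by
  have vanish (c : V → ZMod k) : ∑ D : G.Orient, (-1 : ℂ) ^ flips D D₀ *
      ∏ w, ZMod.stdAddChar (c w * ((outdeg D w : ZMod k) - (outdeg D₀ w : ZMod k))) = 0 := by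
    obtain ⟨u, v, huv, hc⟩ : ∃ u v, G.Adj u v ∧ c u = c v := by
      by_contra! hne
      exact hG (by simpa using (Coloring.mk c fun {u v} huv => hne u v huv).colorable)
    have key := sum_neg_one_pow_flips_mul_prod_eq_zero D₀
      (fun w => (ZMod.stdAddChar (c w) : ℂ)) huv (by simp only [hc])
    rw [← zero_mul (∏ w, (ZMod.stdAddChar (-(c w * (outdeg D₀ w : ZMod k))) : ℂ)), ← key,
      Finset.sum_mul]
    refine Finset.sum_congr rfl fun D _ => ?_
    rw [mul_assoc, ← Finset.prod_mul_distrib]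
    congr 1
    refine Finset.prod_congr rfl fun w _ => ?_
    rw [← AddChar.map_nsmul_eq_pow, ← AddChar.map_add_eq_mul, nsmul_eq_mul]
    congr 1
    ring
  have total := Finset.sum_eq_zero fun c (_ : c ∈ Finset.univ) => vanish c
  rw [Finset.sum_comm] at total
  simp_rw [← Finset.mul_sum, sum_prod_stdAddChar, mul_ite, mul_zero] at total
  rw [← Finset.sum_filter, ← Finset.sum_mul] at total
  exact (mul_eq_zero.mp total).resolve_right (pow_ne_zero _ (NeZero.ne _))

end SimpleGraph.Orient

/-- Sufficiency: if some equivalence class modulo `k` of orientations of `G`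
(the class of a representative `D₀`) has adjacent subclasses of different
cardinalities, then `G` has a proper vertex coloring in at most `k` colors. -/
theorem sufficiency_orientation_criterion
    (G : SimpleGraph V) [DecidableRel G.Adj] (k : ℕ) (hk : 1 ≤ k)
    (h : ∃ D₀ : G.Orient,
      (Finset.univ.filter fun D : G.Orient => CongMod k D D₀ ∧ Agree D D₀).card ≠
      (Finset.univ.filter fun D : G.Orient => CongMod k D D₀ ∧ ¬ Agree D D₀).card) :
    G.Colorable k := by
  have : NeZero k := ⟨by omega⟩
  by_contra hG
  obtain ⟨D₀, hne⟩ := h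
  have hsum := sum_congMod_neg_one_pow_flips_eq_zero k hG D₀
  rw [← Finset.sum_filter_add_sum_filter_not _ (fun D => Agree D D₀), Finset.filter_filter,
    Finset.filter_filter,
    Finset.sum_congr rfl fun D hD => (Finset.mem_filter.mp hD).2.2.neg_one_pow,
    Finset.sum_congr rfl fun D hD =>
      (Nat.not_even_iff_odd.mp (Finset.mem_filter.mp hD).2.2).neg_one_pow] at hsum
  simp only [Finset.sum_const, nsmul_eq_mul, mul_one, mul_neg] at hsum
  exact hne (by exact_mod_cast add_neg_eq_zero.mp hsum)
end

section
/- Necessity part of the colorability criterion: Let G be a finite simple graph and k ≥ 1. If G admits a proper vertex coloring in at most k colors, then for every natural number l with l ≠ 1 and gcd(l, k) = 1 there exists an equivalence class modulo k of orientations of G whose two adjacent subclasses have cardinalities that are incongruent modulo l. -/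
open Finset

variable {V : Type*} [Fintype V] [DecidableEq V]

open SimpleGraph.Orient

namespace SimpleGraph.Orient

variable {G : SimpleGraph V} [DecidableRel G.Adj]

/-- The sign of an orientation relative to a reference one, as a product over edges. -/
lemma neg_one_pow_flips {F : Type*} [CommRing F] (D R : G.Orient) :
    (-1 : F) ^ flips D R = ∏ e : G.edgeFinset, if D.1 e = R.1 e then 1 else -1 := by
  rw [← Finset.prod_const, Finset.prod_filter]
  refine Finset.prod_congr rfl fun e _ => ?_
  by_cases h : D.1 e = R.1 e <;> simp [h]

lemma eq_or_eq_or_eq_of_mem {α : Type*} {z : Sym2 α} {a b c : α} (ha : a ∈ z) (hb : b ∈ z)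
    (hc : c ∈ z) : a = b ∨ b = c ∨ a = c := by
  induction z with | _ x y =>
  simp only [Sym2.mem_iff] at ha hb hc
  grind

lemma neg_one_pow_flips_mul {F : Type*} [CommRing F] (D D₀ R : G.Orient) :
    (-1 : F) ^ flips D R = (-1) ^ flips D D₀ * (-1) ^ flips D₀ R := by
  simp only [neg_one_pow_flips]
  rw [← Finset.prod_mul_distrib]
  refine Finset.prod_congr rfl fun e _ => ?_
  have := eq_or_eq_or_eq_of_mem (D.2 e) (D₀.2 e) (R.2 e)
  by_cases h₁ : D.1 e = D₀.1 e <;> by_cases h₂ : D₀.1 e = R.1 e <;> grind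

lemma prod_source_eq_prod_pow_outdeg {F : Type*} [CommRing F] (x : V → F) (D : G.Orient) :
    ∏ e, x (D.1 e) = ∏ v, x v ^ outdeg D v := by
  rw [← Finset.prod_fiberwise Finset.univ D.1]
  refine Finset.prod_congr rfl fun v _ => ?_
  rw [← Finset.prod_const]
  exact Finset.prod_congr rfl fun e he => by rw [(Finset.mem_filter.1 he).2]

/-- Expansion of the graph polynomial as a signed sum over orientations. -/
lemma prod_sum_eq_sum_orient {F : Type*} [CommRing F] (x : V → F) (R : G.Orient) :
    ∏ e : G.edgeFinset, ∑ v ∈ (e : Sym2 V).toFinset, (if v = R.1 e then 1 else -1) * x v =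
      ∑ D : G.Orient, (-1) ^ flips D R * ∏ v, x v ^ outdeg D v := by
  rw [Finset.prod_univ_sum, Finset.sum_subtype (p := fun D : G.edgeFinset → V =>
    ∀ e : G.edgeFinset, D e ∈ (e : Sym2 V)) _ (by simp [Fintype.mem_piFinset])]
  refine Finset.sum_congr rfl fun D _ => ?_
  rw [Finset.prod_mul_distrib, neg_one_pow_flips, prod_source_eq_prod_pow_outdeg]

lemma prod_sum_ne_zero {F : Type*} [Field F] {x : V → F} (hx : ∀ u v, G.Adj u v → x u ≠ x v)
    (R : G.Orient) :
    ∏ e : G.edgeFinset, ∑ v ∈ (e : Sym2 V).toFinset, (if v = R.1 e then 1 else -1) * x v ≠ 0 := by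
  refine Finset.prod_ne_zero_iff.2 fun e _ => ?_
  have hR := R.2 e
  generalize R.1 e = r at hR
  obtain ⟨z, hz⟩ := e
  induction z with | _ a b =>
  have hab : G.Adj a b := by simpa using hz
  have hne := hab.ne
  have hxab := hx a b hab
  rw [Sym2.toFinset_mk_eq, Finset.sum_pair hne]
  simp only [Sym2.mem_iff] at hR
  rcases hR with rfl | rfl
  · simpa [hne.symm, ← sub_eq_add_neg, sub_eq_zero] using hxab
  · simpa [hne, neg_add_eq_zero] using hxab

lemma pow_eq_pow_of_natCast_eq {M : Type*} [Monoid M] {k m n : ℕ} {y : M} (hy : y ^ k = 1)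
    (h : (m : ZMod k) = n) : y ^ m = y ^ n := by
  rw [pow_eq_pow_mod m hy, pow_eq_pow_mod n hy, (ZMod.natCast_eq_natCast_iff' m n k).1 h]

/-- At `k`-th roots of unity, a class modulo `k` whose adjacent subclasses have equal
cardinalities in `F` contributes zero to the graph polynomial. -/
lemma sum_congMod_eq_zero {F : Type*} [CommRing F] {k : ℕ} {x : V → F} (hx : ∀ v, x v ^ k = 1)
    (R D₀ : G.Orient)
    (h : ((Finset.univ.filter fun D : G.Orient => CongMod k D D₀ ∧ Agree D D₀).card : F) =
      (Finset.univ.filter fun D : G.Orient => CongMod k D D₀ ∧ ¬ Agree D D₀).card) :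
    ∑ D : G.Orient with CongMod k D D₀, (-1) ^ flips D R * ∏ v, x v ^ outdeg D v = 0 := by
  have hterm : ∀ D ∈ Finset.univ.filter fun D : G.Orient => CongMod k D D₀,
      (-1) ^ flips D R * ∏ v, x v ^ outdeg D v =
        (-1) ^ flips D D₀ * ((-1) ^ flips D₀ R * ∏ v, x v ^ outdeg D₀ v) := by
    intro D hD
    rw [neg_one_pow_flips_mul D D₀ R, mul_assoc, Finset.prod_congr rfl fun v _ =>
      pow_eq_pow_of_natCast_eq (hx v) ((Finset.mem_filter.1 hD).2 v)]
  rw [Finset.sum_congr rfl hterm, ← Finset.sum_mul,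
    ← Finset.sum_filter_add_sum_filter_not _ (fun D => Agree D D₀),
    Finset.sum_congr rfl fun D hD => Even.neg_one_pow (Finset.mem_filter.1 hD).2,
    Finset.sum_congr (g := fun _ => (-1 : F)) rfl fun D hD =>
      Odd.neg_one_pow (Nat.not_even_iff_odd.1 (Finset.mem_filter.1 hD).2)]
  simp only [Finset.filter_filter, Finset.sum_const, nsmul_eq_mul, h]
  ring

/-- A graph having suitable `k`-th roots of unity as a proper coloring has a class modulo `k`
whose adjacent subclasses have distinct cardinalities in `F`. -/
lemma exists_card_agree_ne {F : Type*} [Field F] {k : ℕ} {x : V → F} (hx : ∀ v, x v ^ k = 1)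
    (hadj : ∀ u v, G.Adj u v → x u ≠ x v) :
    ∃ D₀ : G.Orient,
      ((Finset.univ.filter fun D : G.Orient => CongMod k D D₀ ∧ Agree D D₀).card : F) ≠
        (Finset.univ.filter fun D : G.Orient => CongMod k D D₀ ∧ ¬ Agree D D₀).card := by
  by_contra! h
  let R : G.Orient := ⟨fun e => (Quot.out (e : Sym2 V)).1, fun e => Sym2.out_fst_mem _⟩
  refine prod_sum_ne_zero hadj R ?_
  rw [prod_sum_eq_sum_orient]
  classical
  let c : G.Orient → V → ZMod k := fun D v => (outdeg D v : ZMod k)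
  rw [← Finset.sum_fiberwise_of_maps_to (t := Finset.univ.image c) (g := c)
    fun D _ => Finset.mem_image_of_mem _ (Finset.mem_univ D)]
  refine Finset.sum_eq_zero fun y hy => ?_
  obtain ⟨D₀, -, rfl⟩ := Finset.mem_image.1 hy
  rw [← sum_congMod_eq_zero hx R D₀ (h D₀)]
  exact Finset.sum_congr (Finset.filter_congr fun D _ => funext_iff) fun _ _ => rfl

end SimpleGraph.Orient

/-- Necessity: if `G` has a proper vertex coloring in at most `k` colors, then
for every natural `l ≠ 1` coprime with `k` there is an equivalence class modulo
`k` of orientations (the class of some `D₀`) whose two adjacent subclasses have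
cardinalities that are incongruent modulo `l`. -/
theorem necessity_orientation_criterion
    (G : SimpleGraph V) [DecidableRel G.Adj] (k : ℕ) (hk : 1 ≤ k)
    (hcol : G.Colorable k) :
    ∀ l : ℕ, l ≠ 1 → Nat.gcd l k = 1 →
      ∃ D₀ : G.Orient,
        ¬ ((Finset.univ.filter fun D : G.Orient =>
              CongMod k D D₀ ∧ Agree D D₀).card ≡
           (Finset.univ.filter fun D : G.Orient =>
              CongMod k D D₀ ∧ ¬ Agree D D₀).card [MOD l]) := by
  intro l hl hlk
  obtain ⟨p, hp, hpl⟩ := Nat.exists_prime_and_dvd hl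
  have : Fact p.Prime := ⟨hp⟩
  have hpk : ¬ p ∣ k := fun h => hp.one_lt.ne' (Nat.dvd_one.1 (hlk ▸ Nat.dvd_gcd hpl h))
  let F := AlgebraicClosure (ZMod p)
  have : CharP F p := charP_of_injective_algebraMap (algebraMap (ZMod p) F).injective p
  have : NeZero (k : F) := ⟨fun h => hpk ((CharP.cast_eq_zero_iff F p k).1 h)⟩
  obtain ⟨ω, hω⟩ := HasEnoughRootsOfUnity.exists_primitiveRoot F k
  obtain ⟨c⟩ := hcol
  obtain ⟨D₀, hD₀⟩ := exists_card_agree_ne (G := G) (k := k) (x := fun v => ω ^ (c v : ℕ))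
    (fun v => by rw [← pow_mul, mul_comm, pow_mul, hω.pow_eq_one, one_pow])
    (fun u v huv h => c.valid huv (Fin.ext (hω.pow_inj (c u).2 (c v).2 h)))
  exact ⟨D₀, fun h => hD₀ ((CharP.cast_eq_iff_mod_eq F p).2 (h.of_dvd hpl))⟩
end

section
/- Criterion for odd k: Let G be a finite simple graph and let k ≥ 1 be an odd natural number. Then G admits a proper vertex coloring in at most k colors if and only if at least one equivalence class modulo k of orientations of G contains an odd number of orientations. -/
open Finset

variable {V : Type*} [Fintype V] [DecidableEq V]

open SimpleGraph.Orient

/-- The graph polynomial `∏ (x_u + x_v)` over the edges `uv` expands as a sum over orientations. -/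
theorem SimpleGraph.Orient.prod_edge_sum_eq_sum_orient (G : SimpleGraph V) [DecidableRel G.Adj]
    {R : Type*} [CommSemiring R] (x : V → R) :
    ∏ e : G.edgeFinset, ∑ u ∈ (e : Sym2 V).toFinset, x u =
      ∑ D : G.Orient, ∏ v, x v ^ outdeg D v := by
  rw [Finset.prod_univ_sum, Finset.sum_subtype (p := fun D : G.edgeFinset → V =>
    ∀ e : G.edgeFinset, D e ∈ (e : Sym2 V)) _ (by simp [Fintype.mem_piFinset])]
  refine Finset.sum_congr rfl fun D _ => ?_
  rw [← Finset.prod_fiberwise Finset.univ D.1]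
  refine Finset.prod_congr rfl fun v _ => ?_
  rw [Finset.prod_congr rfl (g := fun _ => x v), Finset.prod_const]
  intro e he
  rw [(Finset.mem_filter.mp he).2]

/-- In characteristic two, the graph polynomial is nonzero exactly at proper colorings. -/
theorem SimpleGraph.Orient.sum_orient_ne_zero_iff (G : SimpleGraph V) [DecidableRel G.Adj]
    {K : Type*} [Field K] [CharP K 2] (x : V → K) :
    ∑ D : G.Orient, ∏ v, x v ^ outdeg D v ≠ 0 ↔ ∀ u v, G.Adj u v → x u ≠ x v := by
  rw [← prod_edge_sum_eq_sum_orient, Finset.prod_ne_zero_iff]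
  have sum_edge (u v : V) (h : G.Adj u v) : ∑ w ∈ s(u, v).toFinset, x w = x u + x v := by
    rw [Sym2.toFinset_mk_eq, Finset.sum_pair h.ne]
  constructor
  · intro h u v huv
    have := h ⟨s(u, v), by simpa using huv⟩ (Finset.mem_univ _)
    rwa [sum_edge u v huv, Ne, CharTwo.add_eq_zero] at this
  · rintro h ⟨e, he⟩ -
    induction e using Sym2.ind with
    | _ u v =>
      have huv : G.Adj u v := by simpa using he
      rw [sum_edge u v huv, Ne, CharTwo.add_eq_zero]
      exact h u v huv

theorem IsPrimitiveRoot.pow_eq_pow_iff_natCast_eq {M : Type*} [CommMonoid M] {ζ : M} {k : ℕ}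
    (hζ : IsPrimitiveRoot ζ k) [NeZero k] (a b : ℕ) :
    ζ ^ a = ζ ^ b ↔ (a : ZMod k) = (b : ZMod k) := by
  rw [ZMod.natCast_eq_natCast_iff, hζ.eq_orderOf]
  exact (hζ.isOfFinOrder (NeZero.ne k)).pow_eq_pow_iff_modEq

theorem IsPrimitiveRoot.sum_pow_div_pow {K : Type*} [Field K] {ζ : K} {k : ℕ}
    (hζ : IsPrimitiveRoot ζ k) [NeZero k] (a b : ℕ) :
    ∑ j : Fin k, (ζ ^ a / ζ ^ b) ^ (j : ℕ) =
      if (a : ZMod k) = (b : ZMod k) then (k : K) else 0 := by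
  have hb : ζ ^ b ≠ 0 := pow_ne_zero _ (hζ.ne_zero (NeZero.ne k))
  split_ifs with h
  · rw [← hζ.pow_eq_pow_iff_natCast_eq] at h
    simp [h, div_self hb]
  · rw [← hζ.pow_eq_pow_iff_natCast_eq, ← div_eq_one_iff_eq hb, ← sub_eq_zero] at h
    rw [Fin.sum_univ_eq_sum_range (fun j => (ζ ^ a / ζ ^ b) ^ j)]
    refine (mul_eq_zero.mp ?_).resolve_left h
    rw [mul_geom_sum, div_pow, ← pow_mul, ← pow_mul, mul_comm a, mul_comm b, pow_mul, pow_mul,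
      hζ.pow_eq_one]
    simp

/-- Fourier inversion: the size of a class modulo `k`, up to the factor `k ^ |V|`, is a linear
combination of the values of the graph polynomial at tuples of `k`-th roots of unity. -/
theorem SimpleGraph.Orient.sum_inv_mul_sum_orient (G : SimpleGraph V) [DecidableRel G.Adj]
    {K : Type*} [Field K] {ζ : K} {k : ℕ} (hζ : IsPrimitiveRoot ζ k) [NeZero k] (D₀ : G.Orient) :
    ∑ c : V → Fin k, (∏ v, ((ζ ^ (c v : ℕ)) ^ outdeg D₀ v)⁻¹) *
        ∑ D : G.Orient, ∏ v, (ζ ^ (c v : ℕ)) ^ outdeg D v =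
      (Finset.univ.filter fun D : G.Orient => CongMod k D D₀).card * (k : K) ^ Fintype.card V := by
  simp_rw [Finset.mul_sum, ← Finset.prod_mul_distrib]
  rw [Finset.sum_comm, ← nsmul_eq_mul, ← Finset.sum_const, Finset.sum_filter]
  refine Finset.sum_congr rfl fun D _ => ?_
  have key (c : V → Fin k) (v : V) :
      ((ζ ^ (c v : ℕ)) ^ outdeg D₀ v)⁻¹ * (ζ ^ (c v : ℕ)) ^ outdeg D v =
        (ζ ^ outdeg D v / ζ ^ outdeg D₀ v) ^ (c v : ℕ) := by
    rw [div_pow, pow_right_comm ζ (c v : ℕ), pow_right_comm ζ (c v : ℕ), div_eq_inv_mul]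
  simp_rw [key]
  rw [← Fintype.piFinset_univ, ← Finset.prod_univ_sum (fun _ => Finset.univ)
    (fun v (j : Fin k) => (ζ ^ outdeg D v / ζ ^ outdeg D₀ v) ^ (j : ℕ))]
  simp_rw [hζ.sum_pow_div_pow]
  split_ifs with h
  · rw [Finset.prod_congr rfl fun v _ => if_pos (h v)]
    simp
  · obtain ⟨v, hv⟩ := not_forall.mp h
    exact Finset.prod_eq_zero (Finset.mem_univ v) (if_neg hv)

/-- If all classes modulo `k` have even size, then the graph polynomial vanishes in
characteristic two at all tuples of `k`-th roots of unity. -/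
theorem SimpleGraph.Orient.sum_orient_eq_zero_of_even (G : SimpleGraph V) [DecidableRel G.Adj]
    {K : Type*} [Field K] [CharP K 2] {ζ : K} {k : ℕ} (hζ : IsPrimitiveRoot ζ k) [NeZero k]
    (heven : ∀ D₀ : G.Orient,
      Even (Finset.univ.filter fun D : G.Orient => CongMod k D D₀).card)
    (c : V → ℕ) :
    ∑ D : G.Orient, ∏ v, (ζ ^ c v) ^ outdeg D v = 0 := by
  rw [← Finset.sum_fiberwise Finset.univ fun (D : G.Orient) v => (outdeg D v : ZMod k)]
  refine Finset.sum_eq_zero fun d _ => ?_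
  by_cases hd : ∃ D₀ : G.Orient, (fun v => (outdeg D₀ v : ZMod k)) = d
  · obtain ⟨D₀, rfl⟩ := hd
    simp_rw [funext_iff]
    rw [Finset.sum_congr rfl (g := fun _ => ∏ v, (ζ ^ c v) ^ outdeg D₀ v), Finset.sum_const,
      nsmul_eq_mul, (CharP.cast_eq_zero_iff K 2 _).mpr (heven D₀).two_dvd, zero_mul]
    intro D hD
    refine Finset.prod_congr rfl fun v _ => ?_
    rw [pow_right_comm, pow_right_comm ζ (c v),
      (hζ.pow_eq_pow_iff_natCast_eq _ _).mpr ((Finset.mem_filter.mp hD).2 v)]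
  · rw [Finset.filter_false_of_mem fun D _ h => hd ⟨D, h⟩, Finset.sum_empty]

/-- Criterion for odd `k`: `G` has a proper vertex coloring in at most `k`
colors iff some equivalence class modulo `k` of orientations (the class of a
representative `D₀`) contains an odd number of orientations. -/
theorem odd_k_orientation_criterion
    (G : SimpleGraph V) [DecidableRel G.Adj] (k : ℕ) (hk : 1 ≤ k) (hodd : Odd k) :
    G.Colorable k ↔
      ∃ D₀ : G.Orient,
        Odd (Finset.univ.filter fun D : G.Orient => CongMod k D D₀).card := by
  have : NeZero k := ⟨by omega⟩
  have hk_cast : (k : AlgebraicClosure (ZMod 2)) ≠ 0 := by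
    rw [Ne, CharP.cast_eq_zero_iff _ 2]
    exact hodd.not_two_dvd_nat
  have : NeZero (k : AlgebraicClosure (ZMod 2)) := ⟨hk_cast⟩
  obtain ⟨ζ, hζ⟩ := HasEnoughRootsOfUnity.exists_primitiveRoot (AlgebraicClosure (ZMod 2)) k
  constructor
  · rintro ⟨c⟩
    by_contra! h
    refine (sum_orient_ne_zero_iff G fun v => ζ ^ (c v : ℕ)).mpr (fun u v huv heq => ?_)
      (sum_orient_eq_zero_of_even G hζ (fun D₀ => Nat.not_odd_iff_even.mp (h D₀)) _)
    exact c.valid huv (Fin.ext (hζ.pow_inj (c u).isLt (c v).isLt heq))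
  · rintro ⟨D₀, hD₀⟩
    have hne := mul_ne_zero (a := ((Finset.univ.filter fun D : G.Orient =>
      CongMod k D D₀).card : AlgebraicClosure (ZMod 2)))
      (by rw [Ne, CharP.cast_eq_zero_iff _ 2]; exact hD₀.not_two_dvd_nat)
      (pow_ne_zero (Fintype.card V) hk_cast)
    rw [← sum_inv_mul_sum_orient G hζ D₀] at hne
    obtain ⟨c, -, hc⟩ := Finset.exists_ne_zero_of_sum_ne_zero hne
    have hproper := (sum_orient_ne_zero_iff G _).mp (right_ne_zero_of_mul hc)
    exact ⟨SimpleGraph.Coloring.mk c fun {u v} huv heq => hproper u v huv (by rw [heq])⟩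
end

section
/- Signed-count form of the colorability criterion: Let G be a finite simple graph with a fixed reference orientation, and let k ≥ 1. Then G admits a proper vertex coloring in at most k colors if and only if there exists a function t : V → ℤ/kℤ such that the integer Σ_D sign(D) is nonzero, where the sum ranges over all orientations D of G whose outdegree function satisfies s⁺_D(v) ≡ t(v) (mod k) for every vertex v, and sign(D) = (−1)^r with r the number of edges on which D differs from the reference orientation. -/
open Finset

variable {V : Type*} [Fintype V] [DecidableEq V]

open SimpleGraph.Orient

/-- The graph polynomial of an orientation: the product over the edges of the differences
`x_source - x_head` expands as the signed sum of the outdegree monomials. -/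
theorem SimpleGraph.Orient.sum_sign_mul_prod_eq_prod {R : Type*} [CommRing R]
    {G : SimpleGraph V} [DecidableRel G.Adj] (Dref : G.Orient) (x : V → R) :
    ∑ D : G.Orient, (-1 : R) ^ flips D Dref * ∏ e, x (D.1 e) =
      ∏ e, (x (Dref.1 e) - x (head Dref e)) := by
  have edge_sum (e : G.edgeFinset) : x (Dref.1 e) - x (head Dref e) =
      ∑ v ∈ (e : Sym2 V).toFinset, (if v ≠ Dref.1 e then (-1 : R) else 1) * x v := by
    have hspec : s(Dref.1 e, head Dref e) = e := Sym2.other_spec' (Dref.2 e)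
    have hne : head Dref e ≠ Dref.1 e := by
      intro h
      have he := SimpleGraph.mem_edgeFinset.1 e.2
      rw [← hspec, SimpleGraph.mem_edgeSet, h] at he
      exact G.loopless.irrefl _ he
    rw [← hspec, Sym2.toFinset_mk_eq, Finset.sum_pair hne.symm]
    simp [hne, sub_eq_add_neg]
  have term (D : G.edgeFinset → V) :
      ∏ e, (if D e ≠ Dref.1 e then (-1 : R) else 1) * x (D e) =
        (-1 : R) ^ #{e | D e ≠ Dref.1 e} * ∏ e, x (D e) := by
    rw [Finset.prod_mul_distrib, Finset.prod_ite]
    simp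
  simp_rw [edge_sum, Finset.prod_univ_sum, term]
  symm
  apply Finset.sum_subtype
  simp [Fintype.mem_piFinset]

/-- A vertex labelling is proper exactly when the graph polynomial does not vanish at the images
of the labels under an injective map. -/
theorem SimpleGraph.Orient.prod_sub_ne_zero_iff {R C : Type*} [CommRing R] [IsDomain R]
    {G : SimpleGraph V} [DecidableRel G.Adj] (Dref : G.Orient) {f : C → R}
    (hf : Function.Injective f) (c : V → C) :
    ∏ e, (f (c (Dref.1 e)) - f (c (head Dref e))) ≠ 0 ↔ ∀ v w, G.Adj v w → c v ≠ c w := by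
  simp only [Finset.prod_ne_zero_iff, Finset.mem_univ, true_imp_iff, sub_ne_zero, hf.ne_iff]
  have hspec (e : G.edgeFinset) : s(Dref.1 e, head Dref e) = e := Sym2.other_spec' (Dref.2 e)
  constructor
  · intro h v w hvw
    have he := h ⟨s(v, w), SimpleGraph.mem_edgeFinset.2 hvw⟩
    rcases Sym2.eq_iff.1 (hspec ⟨s(v, w), SimpleGraph.mem_edgeFinset.2 hvw⟩) with
      ⟨h₁, h₂⟩ | ⟨h₁, h₂⟩
    · rwa [h₁, h₂] at he
    · rw [h₁, h₂] at he
      exact he.symm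
  · intro h e
    apply h
    rw [← SimpleGraph.mem_edgeSet, hspec]
    exact SimpleGraph.mem_edgeFinset.1 e.2

/-- Evaluating an outdegree monomial at values of an additive character. -/
theorem SimpleGraph.Orient.prod_addChar_eq {R M : Type*} [CommRing R] [CommMonoid M]
    {G : SimpleGraph V} [DecidableRel G.Adj] (D : G.Orient) (χ : AddChar R M) (c : V → R) :
    ∏ e, χ (c (D.1 e)) = ∏ v, χ (c v * outdeg D v) := by
  rw [← Finset.prod_fiberwise univ D.1]
  refine Finset.prod_congr rfl fun v _ => ?_
  rw [Finset.prod_congr rfl (g := fun _ => χ (c v)) (by simp +contextual), Finset.prod_const,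
    ← AddChar.map_nsmul_eq_pow, nsmul_eq_mul, mul_comm]

/-- Orthogonality of the characters `c ↦ ∏ v, χ (c v * s v)` of a finite power of a ring. -/
theorem AddChar.IsPrimitive.sum_prod_mulShift {R S : Type*} [CommRing R] [Fintype R]
    [DecidableEq R] [CommRing S] [IsDomain S] {χ : AddChar R S} (hχ : χ.IsPrimitive) (s : V → R) :
    ∑ c : V → R, ∏ v, χ (c v * s v) =
      if s = 0 then (Fintype.card R : S) ^ Fintype.card V else 0 := by
  rw [← Fintype.prod_sum fun v a => χ (a * s v)]
  simp_rw [AddChar.sum_mulShift _ hχ]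
  split_ifs with h
  · simp [h]
  · obtain ⟨v, hv⟩ := Function.ne_iff.1 h
    exact Finset.prod_eq_zero (Finset.mem_univ v) (by simp [show s v ≠ 0 from hv])

/-- Signed-count criterion: `G` is colorable in at most `k` colors iff for some
outdegree profile `t : V → ℤ/kℤ` the signed number of orientations with that
profile (signs relative to the reference orientation `Dref`) is nonzero. -/
theorem signed_count_orientation_criterion
    (G : SimpleGraph V) [DecidableRel G.Adj] (Dref : G.Orient) (k : ℕ) (hk : 1 ≤ k) :
    G.Colorable k ↔
      ∃ t : V → ZMod k,
        (∑ D ∈ Finset.univ.filter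
            (fun D : G.Orient => ∀ v : V, (outdeg D v : ZMod k) = t v),
          (-1 : ℤ) ^ flips D Dref) ≠ 0 := by
  have : NeZero k := ⟨by omega⟩
  let χ : AddChar (ZMod k) ℂ := ZMod.stdAddChar
  have χ_injective : Function.Injective χ := ZMod.injective_stdAddChar
  have expand (c : V → ZMod k) : ∏ e, (χ (c (Dref.1 e)) - χ (c (head Dref e))) =
      ∑ D : G.Orient, (-1 : ℂ) ^ flips D Dref * ∏ v, χ (c v * outdeg D v) := by
    simp_rw [← sum_sign_mul_prod_eq_prod Dref fun v => χ (c v), prod_addChar_eq]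
  have colorable_iff : G.Colorable k ↔
      ∃ c : V → ZMod k, ∏ e, (χ (c (Dref.1 e)) - χ (c (head Dref e))) ≠ 0 := by
    simp_rw [prod_sub_ne_zero_iff Dref χ_injective]
    constructor
    · intro h
      let C := h.toColoring (α := ZMod k) (by simp [ZMod.card])
      exact ⟨C, fun _ _ hvw => C.valid hvw⟩
    · rintro ⟨c, hc⟩
      simpa [ZMod.card] using
        (SimpleGraph.Coloring.mk c fun {v w} hvw => hc v w hvw).colorable
  rw [colorable_iff]
  constructor
  · rintro ⟨c, hc⟩
    by_contra! h
    refine hc ?_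
    rw [expand, ← Finset.sum_fiberwise univ fun (D : G.Orient) v => (outdeg D v : ZMod k)]
    refine Finset.sum_eq_zero fun t _ => ?_
    rw [Finset.sum_congr rfl
      (g := fun D : G.Orient => (-1 : ℂ) ^ flips D Dref * ∏ v, χ (c v * t v)),
      ← Finset.sum_mul]
    · have ht := congrArg (Int.cast : ℤ → ℂ) (h t)
      push_cast at ht
      simp_rw [funext_iff, ht, zero_mul]
    · intro D hD
      simp [← (Finset.mem_filter.1 hD).2]
  · rintro ⟨t, ht⟩
    by_contra! h
    have inversion : ∑ c : V → ZMod k, (∏ e, (χ (c (Dref.1 e)) - χ (c (head Dref e)))) *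
        ∏ v, χ (c v * -t v) =
        ((∑ D : G.Orient with ∀ v, (outdeg D v : ZMod k) = t v, (-1 : ℤ) ^ flips D Dref : ℤ) : ℂ) *
          (k : ℂ) ^ Fintype.card V := by
      simp_rw [expand, Finset.sum_mul, mul_assoc, ← Finset.prod_mul_distrib,
        ← AddChar.map_add_eq_mul, ← mul_add]
      rw [Finset.sum_comm]
      simp_rw [← Finset.mul_sum]
      push_cast
      rw [Finset.sum_filter, Finset.sum_mul]
      refine Finset.sum_congr rfl fun D _ => ?_
      rw [(ZMod.isPrimitive_stdAddChar k).sum_prod_mulShift fun v => (outdeg D v : ZMod k) + -t v]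
      simp [funext_iff, add_neg_eq_zero, ZMod.card]
    simp_rw [h, zero_mul, Finset.sum_const_zero] at inversion
    refine mul_ne_zero (Int.cast_ne_zero.2 ht) (pow_ne_zero _ ?_) inversion.symm
    exact_mod_cast NeZero.ne k
end

section
/- Orientation expansion of the graph polynomial: Let G be a finite simple graph with vertex set V, edge set E, and a fixed reference orientation assigning to each edge e the ordered pair (h(e), t(e)) of its endpoints. Then, in the ring of multivariate polynomials over ℤ in variables (x_v)_{v ∈ V}, the identity ∏_{e ∈ E} (x_{h(e)} − x_{t(e)}) = Σ_D sign(D) · ∏_{v ∈ V} x_v^{s⁺_D(v)} holds, where the sum ranges over all orientations D of G, s⁺_D(v) is the outdegree of v in D, and sign(D) = (−1)^r with r the number of edges on which D differs from the reference orientation. -/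
open Finset

variable {V : Type*} [Fintype V] [DecidableEq V]

open SimpleGraph.Orient

namespace SimpleGraph.Orient

variable {G : SimpleGraph V} [DecidableRel G.Adj]

lemma filter_mem_edge_eq (D : G.Orient) (e : G.edgeFinset) :
    (univ.filter fun v => v ∈ (e : Sym2 V)) = {D.1 e, head D e} := by
  ext v
  have h : v ∈ s(D.1 e, head D e) ↔ v ∈ (e : Sym2 V) := by rw [Sym2.other_spec' (D.2 e)]
  rw [mem_filter, ← h, Sym2.mem_iff, mem_insert, mem_singleton]
  exact and_iff_right (mem_univ v)

lemma head_ne (D : G.Orient) (e : G.edgeFinset) : head D e ≠ D.1 e := by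
  rw [head, ← Sym2.other_eq_other']
  exact Sym2.other_ne (G.not_isDiag_of_mem_edgeFinset e.2) (D.2 e)

lemma prod_apply_eq_prod_pow_outdeg {M : Type*} [CommMonoid M] (D : G.Orient) (f : V → M) :
    ∏ e, f (D.1 e) = ∏ v, f v ^ outdeg D v := by
  rw [← prod_fiberwise' univ D.1 f]
  simp [outdeg]

lemma prod_sign_eq_pow_flips {R : Type*} [CommRing R] (D D' : G.Orient) :
    ∏ e, (if D.1 e ≠ D'.1 e then (-1 : R) else 1) = (-1) ^ flips D D' := by
  rw [prod_ite, prod_const, prod_const_one, mul_one]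

/-- An edge factor as a signed sum over the endpoints of the edge. -/
lemma sub_eq_sum_endpoints {R : Type*} [CommRing R] (D : G.Orient) (f : V → R)
    (e : G.edgeFinset) :
    f (D.1 e) - f (head D e) =
      ∑ v ∈ univ.filter (fun v => v ∈ (e : Sym2 V)),
        (if v ≠ D.1 e then (-1 : R) else 1) * f v := by
  rw [filter_mem_edge_eq D e, sum_pair (head_ne D e).symm, if_pos (head_ne D e),
    if_neg (not_not.mpr rfl)]
  ring

/-- The orientation expansion of `∏ e, (f (h e) - f (t e))` in any commutative ring. -/
lemma prod_sub_eq_sum {R : Type*} [CommRing R] (D' : G.Orient) (f : V → R) :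
    ∏ e, (f (D'.1 e) - f (head D' e)) =
      ∑ D : G.Orient, (-1) ^ flips D D' * ∏ v, f v ^ outdeg D v := by
  simp_rw [sub_eq_sum_endpoints, prod_univ_sum]
  rw [sum_subtype _ (p := fun D : G.edgeFinset → V => ∀ e : G.edgeFinset, D e ∈ (e : Sym2 V))
    (by simp)]
  refine sum_congr rfl fun D _ => ?_
  rw [prod_mul_distrib, prod_sign_eq_pow_flips, prod_apply_eq_prod_pow_outdeg]

end SimpleGraph.Orient

/-- Orientation expansion of the graph polynomial:
`∏_{e ∈ E} (x_{h(e)} − x_{t(e)}) = Σ_D sign(D) · ∏_v x_v^{s⁺_D(v)}`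
in `ℤ[x_v : v ∈ V]`, the sum ranging over all orientations `D` of `G`. -/
theorem orientation_expansion_graph_polynomial
    (G : SimpleGraph V) [DecidableRel G.Adj] (Dref : G.Orient) :
    (∏ e : G.edgeFinset,
        (MvPolynomial.X (Dref.1 e) - MvPolynomial.X (head Dref e)) :
      MvPolynomial V ℤ) =
      ∑ D : G.Orient,
        MvPolynomial.C ((-1 : ℤ) ^ flips D Dref) *
          ∏ v : V, MvPolynomial.X v ^ outdeg D v := by
  simpa using prod_sub_eq_sum Dref (MvPolynomial.X : V → MvPolynomial V ℤ)
end

section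
/- Coefficients of the graph polynomial count orientations: Let G be a finite simple graph with vertex set V, edge set E, and a fixed reference orientation assigning to each edge e the ordered pair (h(e), t(e)) of its endpoints. For every function s : V → ℕ, the coefficient of the monomial ∏_{v ∈ V} x_v^{s(v)} in the polynomial ∏_{e ∈ E} (x_{h(e)} − x_{t(e)}) over ℤ equals the number of orientations D of G with outdegree function s⁺_D = s that agree with the reference orientation minus the number of orientations D with s⁺_D = s that disagree with it. -/
open Finset

variable {V : Type*} [Fintype V] [DecidableEq V]

open SimpleGraph.Orient

/-- The polynomial `x_{h(e)} - x_{t(e)}` of an edge as a signed sum over its endpoints. -/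
theorem SimpleGraph.Orient.X_sub_X_eq_sum {G : SimpleGraph V} [DecidableRel G.Adj]
    (D : G.Orient) (e : G.edgeFinset) :
    (MvPolynomial.X (D.1 e) - MvPolynomial.X (head D e) : MvPolynomial V ℤ) =
      ∑ v ∈ (e : Sym2 V).toFinset,
        (if v ≠ D.1 e then -1 else 1) * MvPolynomial.X v := by
  have hspec : s(D.1 e, head D e) = (e : Sym2 V) := Sym2.other_spec' (D.2 e)
  have hne : D.1 e ≠ head D e := by
    have hadj := SimpleGraph.mem_edgeFinset.mp e.2
    rw [← hspec, SimpleGraph.mem_edgeSet] at hadj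
    exact hadj.ne
  have hfin : (e : Sym2 V).toFinset = {D.1 e, head D e} := by
    ext v
    rw [Sym2.mem_toFinset, ← hspec, Sym2.mem_iff, Finset.mem_insert, Finset.mem_singleton]
  rw [hfin, Finset.sum_pair hne]
  simp [hne.symm, sub_eq_add_neg]

/-- The product of the source variables of an orientation is the monomial of its outdegrees. -/
theorem SimpleGraph.Orient.prod_X_eq_monomial_outdeg {G : SimpleGraph V} [DecidableRel G.Adj]
    (D : G.Orient) :
    (∏ e : G.edgeFinset, MvPolynomial.X (D.1 e) : MvPolynomial V ℤ) =
      MvPolynomial.monomial (Finsupp.equivFunOnFinite.symm (outdeg D)) 1 := by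
  rw [← Finset.prod_fiberwise_of_maps_to (t := Finset.univ) (g := D.1) fun _ _ => mem_univ _,
    MvPolynomial.monomial_eq, Finsupp.prod_fintype _ _ fun _ => pow_zero _, map_one, one_mul]
  refine Finset.prod_congr rfl fun v _ => ?_
  exact Finset.prod_eq_pow_card fun e he => by rw [(Finset.mem_filter.mp he).2]

/-- The graph polynomial is the signed sum of the outdegree monomials of all orientations. -/
theorem SimpleGraph.Orient.prod_X_sub_X_eq_sum {G : SimpleGraph V} [DecidableRel G.Adj]
    (Dref : G.Orient) :
    (∏ e : G.edgeFinset, (MvPolynomial.X (Dref.1 e) - MvPolynomial.X (head Dref e)) :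
        MvPolynomial V ℤ) =
      ∑ D : G.Orient,
        MvPolynomial.monomial (Finsupp.equivFunOnFinite.symm (outdeg D))
          ((-1) ^ flips D Dref) := by
  simp_rw [X_sub_X_eq_sum]
  rw [Finset.prod_univ_sum, Finset.sum_subtype
    (p := fun D : G.edgeFinset → V => ∀ e : G.edgeFinset, D e ∈ (e : Sym2 V))]
  · refine Finset.sum_congr rfl fun D _ => ?_
    rw [Finset.prod_mul_distrib, prod_X_eq_monomial_outdeg, Finset.prod_ite,
      Finset.prod_const, Finset.prod_const_one, mul_one, ← mul_one ((-1 : ℤ) ^ _),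
      ← MvPolynomial.C_mul_monomial, map_pow, map_neg, MvPolynomial.C_1]
  · simp [Fintype.mem_piFinset]

/-- Coefficients of the graph polynomial count orientations: the coefficient of
`∏_v x_v^{s v}` in `∏_{e ∈ E} (x_{h(e)} − x_{t(e)})` equals the number of
orientations with outdegree function `s` agreeing with the reference orientation
minus the number of those disagreeing with it. -/
theorem coeff_graph_polynomial_counts_orientations
    (G : SimpleGraph V) [DecidableRel G.Adj] (Dref : G.Orient) (s : V → ℕ) :
    MvPolynomial.coeff (Finsupp.equivFunOnFinite.symm s)
        (∏ e : G.edgeFinset,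
          (MvPolynomial.X (Dref.1 e) - MvPolynomial.X (head Dref e)) :
          MvPolynomial V ℤ) =
      ((Finset.univ.filter fun D : G.Orient =>
          (∀ v : V, outdeg D v = s v) ∧ Agree D Dref).card : ℤ) -
      ((Finset.univ.filter fun D : G.Orient =>
          (∀ v : V, outdeg D v = s v) ∧ ¬ Agree D Dref).card : ℤ) := by
  rw [prod_X_sub_X_eq_sum, MvPolynomial.coeff_sum, Finset.card_filter, Finset.card_filter]
  push_cast
  rw [← Finset.sum_sub_distrib]
  refine Finset.sum_congr rfl fun D _ => ?_
  rw [MvPolynomial.coeff_monomial]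
  simp only [Finsupp.equivFunOnFinite.symm.injective.eq_iff, funext_iff]
  by_cases hs : ∀ v, outdeg D v = s v
  · by_cases ha : Agree D Dref
    · simp only [hs, ha, Even.neg_one_pow ha]
      simp
    · simp only [hs, ha, Odd.neg_one_pow (Nat.not_even_iff_odd.mp ha)]
      simp
  · simp only [hs, false_and, if_false, sub_zero]
end

section
/- Colorability and the reduced graph polynomial over a finite field: Let G be a finite simple graph with vertex set V and a fixed reference orientation, let k ≥ 1, let q be a prime power with q ≡ 1 (mod k), and let F be a finite field with q elements. Then G admits a proper vertex coloring in at most k colors if and only if there exists a function t : V → ℤ/kℤ such that the image in F of the integer Σ_D sign(D) is nonzero, where the sum ranges over all orientations D of G whose outdegree function satisfies s⁺_D(v) ≡ t(v) (mod k) for every vertex v, and sign(D) = (−1)^r with r the number of edges on which D differs from the reference orientation. -/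
open Finset

variable {V : Type*} [Fintype V] [DecidableEq V]

namespace SimpleGraph.Orient

variable {G : SimpleGraph V} [DecidableRel G.Adj]

/-- The graph polynomial `∏ₑ (x (tail e) - x (head e))` evaluated at `x`, written as the product
over the edges of the signed sum of `x` over both endpoints. -/
def signedEdgeProd {F : Type*} [Field F] (Dref : G.Orient) (x : V → F) : F :=
  ∏ e : G.edgeFinset, ∑ v : V with v ∈ (e : Sym2 V), (if v ≠ Dref.1 e then -1 else 1) * x v

/-- The number of orientations with outdegrees congruent to `t`, counted with sign. -/
def signedCount (Dref : G.Orient) {k : ℕ} (t : V → ZMod k) : ℤ :=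
  ∑ D : G.Orient with ∀ v : V, (outdeg D v : ZMod k) = t v, (-1 : ℤ) ^ flips D Dref

lemma signedEdgeProd_eq_sum_orient {F : Type*} [Field F] (Dref : G.Orient) (x : V → F) :
    signedEdgeProd Dref x = ∑ D : G.Orient, (-1) ^ flips D Dref * ∏ v, x v ^ outdeg D v := by
  rw [signedEdgeProd, Finset.prod_univ_sum,
    Finset.sum_subtype (p := fun D : G.edgeFinset → V => ∀ e : G.edgeFinset, D e ∈ (e : Sym2 V)) _
      (fun D => by simp [Fintype.mem_piFinset])]
  refine Finset.sum_congr rfl fun D _ => ?_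
  rw [Finset.prod_mul_distrib, Finset.prod_ite, Finset.prod_const, Finset.prod_const_one, mul_one]
  congr 1
  rw [← Finset.prod_fiberwise (s := Finset.univ) (g := fun e => D.1 e)]
  refine Finset.prod_congr rfl fun v _ => ?_
  rw [Finset.prod_congr rfl (g := fun _ => x v) (fun e he => by rw [(Finset.mem_filter.1 he).2]),
    Finset.prod_const]

lemma signedEdgeProd_eq_sum_signedCount {F : Type*} [Field F] (Dref : G.Orient) {k : ℕ} [NeZero k]
    (x : V → F) (hx : ∀ v, x v ^ k = 1) :
    signedEdgeProd Dref x =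
      ∑ t : V → ZMod k, (signedCount Dref t : F) * ∏ v, x v ^ (t v).val := by
  rw [signedEdgeProd_eq_sum_orient,
    ← Finset.sum_fiberwise (s := Finset.univ)
      (g := fun (D : G.Orient) (v : V) => (outdeg D v : ZMod k))]
  refine Finset.sum_congr rfl fun t _ => ?_
  rw [signedCount, Int.cast_sum, Finset.sum_mul]
  simp only [funext_iff]
  refine Finset.sum_congr rfl fun D hD => ?_
  push_cast
  congr 1
  refine Finset.prod_congr rfl fun v _ => ?_
  rw [← (Finset.mem_filter.1 hD).2 v, ZMod.val_natCast]
  exact pow_eq_pow_mod _ (hx v)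

lemma signedEdgeProd_ne_zero_iff {F : Type*} [Field F] (Dref : G.Orient) (x : V → F) :
    signedEdgeProd Dref x ≠ 0 ↔ ∀ u v, G.Adj u v → x u ≠ x v := by
  have sum_edge (u v : V) (h : G.Adj u v) (f : V → F) :
      ∑ w : V with w ∈ s(u, v), f w = f u + f v := by
    rw [← Finset.sum_pair h.ne]
    exact Finset.sum_congr (by ext; simp) fun _ _ => rfl
  have sum_ne_zero (u v : V) (h : G.Adj u v) (d : V) (hd : d ∈ s(u, v)) :
      (∑ w : V with w ∈ s(u, v), (if w ≠ d then -1 else 1) * x w) ≠ 0 ↔ x u ≠ x v := by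
    rw [sum_edge u v h]
    rcases Sym2.mem_iff.1 hd with rfl | rfl
    · simp [h.ne', ← sub_eq_add_neg, sub_eq_zero]
    · simp [h.ne, neg_add_eq_zero]
  rw [signedEdgeProd, Finset.prod_ne_zero_iff]
  constructor
  · intro H u v h
    have he : s(u, v) ∈ G.edgeFinset := by simpa using h
    exact (sum_ne_zero u v h _ (Dref.2 ⟨_, he⟩)).1 (H ⟨_, he⟩ (Finset.mem_univ _))
  · rintro H ⟨e, he⟩ -
    induction e with
    | h u v =>
      have h : G.Adj u v := by simpa using he
      exact (sum_ne_zero u v h _ (Dref.2 ⟨_, he⟩)).2 (H u v h)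

end SimpleGraph.Orient

/-- A polynomial with exponents `< k` that vanishes on the grid of `k`-th roots of unity has zero
coefficients. -/
lemma coeff_eq_zero_of_vanish_on_nthRoots {F : Type*} [Field F] {k : ℕ} [NeZero k]
    (hcard : (Polynomial.nthRootsFinset k (1 : F)).card = k) (c : (V → ZMod k) → F)
    (h : ∀ x : V → F, (∀ v, x v ^ k = 1) → ∑ t, c t * ∏ v, x v ^ (t v).val = 0)
    (t : V → ZMod k) : c t = 0 := by
  let expo (t : V → ZMod k) : V →₀ ℕ := Finsupp.equivFunOnFinite.symm fun v => (t v).val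
  have expo_inj : Function.Injective expo := fun s t hst => by
    funext v
    exact ZMod.val_injective k (DFunLike.congr_fun hst v)
  let P : MvPolynomial V F := ∑ t, MvPolynomial.monomial (expo t) (c t)
  have hP : P = 0 := by
    refine MvPolynomial.eq_zero_of_eval_zero_at_prod_finset P
      (fun _ => Polynomial.nthRootsFinset k 1) (fun v => ?_) (fun x hx => ?_)
    · rw [hcard, MvPolynomial.degreeOf_lt_iff (NeZero.pos k)]
      intro m hm
      obtain ⟨s, -, hs⟩ := Finset.mem_biUnion.1 (MvPolynomial.support_sum hm)
      rw [Finset.mem_singleton.1 (MvPolynomial.support_monomial_subset hs)]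
      exact ZMod.val_lt (s v)
    · rw [← h x fun v => (Polynomial.mem_nthRootsFinset (NeZero.pos k) 1).1 (hx v)]
      simp only [P, map_sum, MvPolynomial.eval_monomial]
      refine Finset.sum_congr rfl fun s _ => ?_
      rw [Finsupp.prod_fintype _ _ (by simp)]
      rfl
  have := congrArg (MvPolynomial.coeff (expo t)) hP
  simpa [P, MvPolynomial.coeff_sum, MvPolynomial.coeff_monomial, expo_inj.eq_iff] using this

lemma card_nthRootsFinset_of_card_modEq_one {F : Type*} [Field F] [Fintype F] {k : ℕ}
    (hF : Fintype.card F ≡ 1 [MOD k]) :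
    (Polynomial.nthRootsFinset k (1 : F)).card = k := by
  classical
  obtain ⟨g, hg⟩ := IsCyclic.exists_ofOrder_eq_natCard (α := Fˣ)
  rw [Nat.card_eq_fintype_card, Fintype.card_units] at hg
  obtain ⟨m, hm⟩ := (Nat.modEq_iff_dvd' Fintype.card_pos).1 hF.symm
  have hroot : IsPrimitiveRoot (g : F) (Fintype.card F - 1) :=
    IsPrimitiveRoot.coe_units_iff.2 (hg ▸ IsPrimitiveRoot.orderOf g)
  have hpos : 0 < Fintype.card F - 1 := Nat.sub_pos_of_lt Fintype.one_lt_card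
  exact (hroot.pow hpos (hm.trans (mul_comm k m))).card_nthRootsFinset

open SimpleGraph.Orient

/-- Colorability and the reduced graph polynomial over a finite field `F` with
`q ≡ 1 (mod k)` elements: `G` is colorable in at most `k` colors iff for some
outdegree profile `t : V → ℤ/kℤ` the image in `F` of the signed number of
orientations with that profile is nonzero. -/
theorem colorable_iff_signed_count_ne_zero_in_field
    (G : SimpleGraph V) [DecidableRel G.Adj] (Dref : G.Orient)
    (k : ℕ) (hk : 1 ≤ k) (F : Type*) [Field F] [Fintype F]
    (hF : Fintype.card F ≡ 1 [MOD k]) :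
    G.Colorable k ↔
      ∃ t : V → ZMod k,
        (((∑ D ∈ Finset.univ.filter
              (fun D : G.Orient => ∀ v : V, (outdeg D v : ZMod k) = t v),
            (-1 : ℤ) ^ flips D Dref) : ℤ) : F) ≠ 0 := by
  change _ ↔ ∃ t : V → ZMod k, (signedCount Dref t : F) ≠ 0
  have : NeZero k := ⟨Nat.one_le_iff_ne_zero.1 hk⟩
  have hcard := card_nthRootsFinset_of_card_modEq_one hF
  have mem_roots (a : F) : a ∈ Polynomial.nthRootsFinset k (1 : F) ↔ a ^ k = 1 :=
    Polynomial.mem_nthRootsFinset hk 1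
  constructor
  · rintro ⟨C⟩
    by_contra! hzero
    let r := (Finset.equivFinOfCardEq hcard).symm
    refine (signedEdgeProd_ne_zero_iff Dref fun v => (r (C v) : F)).2
      (fun u v h heq => C.valid h (r.injective (Subtype.ext heq))) ?_
    rw [signedEdgeProd_eq_sum_signedCount (k := k) Dref _
      fun v => (mem_roots _).1 (r (C v)).2]
    simp [hzero]
  · rintro ⟨t, ht⟩
    by_contra hcol
    refine ht (coeff_eq_zero_of_vanish_on_nthRoots hcard
      (fun t => (signedCount Dref t : F)) (fun x hx => ?_) t)
    rw [← signedEdgeProd_eq_sum_signedCount Dref x hx]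
    by_contra hne
    have hproper := (signedEdgeProd_ne_zero_iff Dref x).1 hne
    let C : G.Coloring (Polynomial.nthRootsFinset k (1 : F)) :=
      SimpleGraph.Coloring.mk (fun v => ⟨x v, (mem_roots _).2 (hx v)⟩)
        fun {u v} h heq => hproper u v h (congrArg Subtype.val heq)
    exact hcol (by simpa [hcard] using C.colorable)
end

section
/- Even cycles show the coprimality condition is essential: Let n be an even natural number with n ≥ 4, and let C_n be the cycle graph on n vertices. Then every equivalence class modulo 2 of orientations of C_n is either empty or contains exactly 2 orientations. -/
open Finset

variable {V : Type*} [Fintype V] [DecidableEq V]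

open SimpleGraph.Orient

namespace SimpleGraph.Orient

/-- The orientation obtained by reversing every edge. -/
def reverse {G : SimpleGraph V} [DecidableRel G.Adj] (D : G.Orient) : G.Orient :=
  ⟨fun e => head D e, fun e => Sym2.other_mem' (D.2 e)⟩

/-- The edge joining `i` to `i + 1` in a cycle of length at least `3`. -/
def cycleEdge {m : ℕ} (i : Fin (m + 3)) : (SimpleGraph.cycleGraph (m + 3)).edgeFinset :=
  ⟨s(i, i + 1), by simp [SimpleGraph.cycleGraph_adj]⟩

theorem fin_add_two_ne {m : ℕ} (i : Fin (m + 3)) : i + 1 + 1 ≠ i := by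
  intro h
  have h2 : (1 + 1 : Fin (m + 3)) = 0 := by
    rwa [add_assoc, add_eq_left] at h
  have := congrArg Fin.val h2
  simp [Fin.val_add, Nat.mod_eq_of_lt (show 2 < m + 3 by omega)] at this

theorem cycleEdge_bijective {m : ℕ} : Function.Bijective (cycleEdge (m := m)) := by
  constructor
  · intro i j h
    have h' : s(i, i + 1) = s(j, j + 1) := congrArg Subtype.val h
    rw [Sym2.eq_iff] at h'
    rcases h' with h' | ⟨h1, h2⟩
    · exact h'.1
    · exact absurd (h1 ▸ h2) (fin_add_two_ne j)
  · rintro ⟨e, he⟩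
    induction e using Sym2.ind with
    | _ u v =>
      have hadj : (SimpleGraph.cycleGraph (m + 3)).Adj u v := by simpa using he
      rw [SimpleGraph.cycleGraph_adj] at hadj
      rcases hadj with h | h
      · refine ⟨v, Subtype.ext ?_⟩
        rw [sub_eq_iff_eq_add'] at h
        simp [cycleEdge, h, Sym2.eq_swap]
      · refine ⟨u, Subtype.ext ?_⟩
        rw [sub_eq_iff_eq_add'] at h
        simp [cycleEdge, h]

section Cycle

variable {m : ℕ} (D D' : (SimpleGraph.cycleGraph (m + 3)).Orient)

theorem source_cycleEdge (i : Fin (m + 3)) :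
    D.1 (cycleEdge i) = i ∨ D.1 (cycleEdge i) = i + 1 := by
  simpa [cycleEdge] using D.2 (cycleEdge i)

/-- The indicator, modulo `2`, that the edge from `i` to `i + 1` leaves `i`. -/
def forward (i : Fin (m + 3)) : ZMod 2 := if D.1 (cycleEdge i) = i then 1 else 0

theorem forward_injective :
    Function.Injective (forward : (SimpleGraph.cycleGraph (m + 3)).Orient → _) := by
  intro D D' h
  refine Subtype.ext (funext fun e => ?_)
  obtain ⟨i, rfl⟩ := cycleEdge_bijective.2 e
  have hi := congrFun h i
  have := source_cycleEdge D i
  have := source_cycleEdge D' i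
  unfold forward at hi
  split_ifs at hi <;> simp_all

theorem forward_reverse (i : Fin (m + 3)) : forward (reverse D) i = forward D i + 1 := by
  have hs : s(D.1 (cycleEdge i), (reverse D).1 (cycleEdge i)) = s(i, i + 1) :=
    Sym2.other_spec' (D.2 (cycleEdge i))
  have hne : i + 1 ≠ i := by simp
  rw [Sym2.eq_iff] at hs
  unfold forward
  rcases hs with ⟨h1, h2⟩ | ⟨h1, h2⟩
  · rw [h1, h2, if_neg hne, if_pos rfl]; rfl
  · rw [h1, h2, if_neg hne, if_pos rfl]; rfl

theorem outdeg_succ_eq (i : Fin (m + 3)) :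
    (outdeg D (i + 1) : ZMod 2) = forward D (i + 1) + (forward D i + 1) := by
  have hne : i + 1 ≠ i := by simp
  have hsum : (outdeg D (i + 1) : ZMod 2) =
      ∑ j : Fin (m + 3), if D.1 (cycleEdge j) = i + 1 then 1 else 0 := by
    rw [outdeg, Finset.natCast_card_filter]
    exact (cycleEdge_bijective.sum_comp fun e => if D.1 e = i + 1 then (1 : ZMod 2) else 0).symm
  rw [hsum, Fintype.sum_eq_add (i + 1) i hne]
  · congr 1
    unfold forward
    rcases source_cycleEdge D i with h | h
    · rw [h, if_neg hne.symm, if_pos rfl]; rfl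
    · rw [h, if_neg hne, if_pos rfl]; rfl
  · rintro j ⟨h1, h2⟩
    refine if_neg fun h => ?_
    rcases source_cycleEdge D j with h' | h'
    · exact h1 (h'.symm.trans h)
    · exact h2 (add_right_cancel (h'.symm.trans h))

theorem congMod_two_reverse : CongMod 2 (reverse D) D := by
  intro v
  obtain ⟨i, rfl⟩ : ∃ i, v = i + 1 := ⟨v - 1, by simp⟩
  rw [outdeg_succ_eq, outdeg_succ_eq, forward_reverse, forward_reverse]
  linear_combination CharTwo.two_eq_zero (R := ZMod 2)

theorem reverse_ne : reverse D ≠ D := by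
  intro h
  have := forward_reverse D 0
  rw [h] at this
  simp at this

theorem eq_or_eq_reverse_of_congMod_two (h : CongMod 2 D' D) : D' = D ∨ D' = reverse D := by
  have hstep (i : Fin (m + 3)) :
      forward D' (i + 1) - forward D (i + 1) = forward D' i - forward D i := by
    have := h (i + 1)
    rw [outdeg_succ_eq, outdeg_succ_eq] at this
    linear_combination this - (forward D' i - forward D i) * CharTwo.two_eq_zero (R := ZMod 2)
  have hconst (i : Fin (m + 3)) : forward D' i - forward D i = forward D' 0 - forward D 0 := by
    induction i using Fin.induction with
    | zero => rfl
    | succ i ih => rw [← Fin.coeSucc_eq_succ, hstep, ih]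
  have hcases : ∀ c : ZMod 2, c = 0 ∨ c = 1 := by decide
  rcases hcases (forward D' 0 - forward D 0) with h0 | h0
  · left
    refine forward_injective (funext fun i => ?_)
    exact sub_eq_zero.1 ((hconst i).trans h0)
  · right
    refine forward_injective (funext fun i => ?_)
    rw [forward_reverse]
    exact sub_eq_iff_eq_add'.1 ((hconst i).trans h0)

end Cycle

end SimpleGraph.Orient

/-- For an even cycle `C_n` (`n ≥ 4` even), every equivalence class modulo `2`
of orientations is either empty or contains exactly `2` orientations. -/
theorem even_cycle_classes_mod_two
    (n : ℕ) (hn : Even n) (h4 : 4 ≤ n) :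
    ∀ t : Fin n → ZMod 2,
      (Finset.univ.filter fun D : (SimpleGraph.cycleGraph n).Orient =>
          ∀ v : Fin n, (outdeg D v : ZMod 2) = t v).card = 0 ∨
      (Finset.univ.filter fun D : (SimpleGraph.cycleGraph n).Orient =>
          ∀ v : Fin n, (outdeg D v : ZMod 2) = t v).card = 2 := by
  intro t
  obtain ⟨m, rfl⟩ : ∃ m, n = m + 3 := ⟨n - 3, by omega⟩
  rw [or_iff_not_imp_left, Finset.card_eq_zero, ← ne_eq, ← Finset.nonempty_iff_ne_empty]
  rintro ⟨D, hD⟩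
  rw [Finset.mem_filter_univ] at hD
  rw [Finset.card_eq_two]
  refine ⟨D, reverse D, (reverse_ne D).symm, ?_⟩
  ext D'
  rw [Finset.mem_filter_univ, Finset.mem_insert, Finset.mem_singleton]
  constructor
  · exact fun h => eq_or_eq_reverse_of_congMod_two D D' fun v => (h v).trans (hD v).symm
  · rintro (rfl | rfl)
    · exact hD
    · exact fun v => (congMod_two_reverse D v).trans (hD v)
end
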